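/- arXiv:2410.03222 — 4 statements merged into one kernel-verified Lean document; each statement's English description precedes it below -/
import Mathlib

section
/- (Local Lipschitz continuity of the GOWA robust objective, Theorem 3.2.) Suppose each of the functions f_1, …, f_p : ℝ^n → ℝ is locally Lipschitz continuous and strictly positive, i.e., f_j(x) > 0 for all x ∈ ℝ^n and all j. Then for every λ > 0 and every choice of weights w_1, …, w_p ≥ 0 with ∑_{i=1}^p w_i = 1, the GOWA robust objective function φ is locally Lipschitz continuous on ℝ^n. -/
/- The `i`-th largest element (0-indexed) of a multiset of reals, counted with
multiplicity; junk value `0` if `i` is out of range. -/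
open Classical in
noncomputable def orderStatM (s : Multiset ℝ) (i : ℕ) : ℝ :=
  (s.sort (· ≤ ·)).getD (Multiset.card s - 1 - i) 0

/-- `orderStat v i` is the `i`-th largest value (0-indexed) among `v 0, …, v (p-1)`,
counted with multiplicity; it is the order statistic `s_{i+1}` of the paper, so that
`orderStat v 0 ≥ orderStat v 1 ≥ ⋯ ≥ orderStat v (p-1)`. -/
noncomputable def orderStat {p : ℕ} (v : Fin p → ℝ) (i : Fin p) : ℝ :=
  orderStatM (Finset.univ.val.map v) i.val

/-- The GOWA aggregation `φ` applied to the values `v j = f_j(x)`: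
`φ = (∑ i, w i * (s_i)^λ)^(1/λ)` (real powers). -/
noncomputable def gowa {p : ℕ} (w : Fin p → ℝ) (lam : ℝ) (v : Fin p → ℝ) : ℝ :=
  (∑ i : Fin p, w i * (orderStat v i) ^ lam) ^ (1 / lam)

/-- The decreasing rearrangement is the increasing one read backwards. -/
theorem orderStat_eq_sort {p : ℕ} (v : Fin p → ℝ) (i : Fin p) :
    orderStat v i = v (Tuple.sort v i.rev) := by
  classical
  have hsort : (Finset.univ.val.map v).sort (· ≤ ·) = List.ofFn (v ∘ Tuple.sort v) := by
    refine List.Perm.eq_of_pairwise (le := (· ≤ ·)) (fun _ _ _ _ h h' => le_antisymm h h')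
      (Multiset.pairwise_sort _ _) (List.sortedLE_ofFn_iff.2 (Tuple.monotone_sort v)).pairwise ?_
    rw [← Multiset.coe_eq_coe, Multiset.sort_eq]
    have hperm : (List.ofFn (v ∘ Tuple.sort v)).Perm (List.ofFn v) :=
      Equiv.Perm.ofFn_comp_perm (Tuple.sort v) v
    rw [Multiset.coe_eq_coe.2 hperm, Fin.univ_val_map]
  have hi : p - 1 - i.val < p := by omega
  have hrev : (⟨p - 1 - i.val, hi⟩ : Fin p) = i.rev := by
    ext
    simp only [Fin.val_rev]
    omega
  simp only [orderStat, orderStatM]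
  rw [hsort]
  simp [List.getD_eq_getElem?_getD, hi, hrev]

theorem sort_le_sort_add {p : ℕ} {u v : Fin p → ℝ} {c : ℝ} (h : ∀ j, u j ≤ v j + c)
    (k : Fin p) : u (Tuple.sort u k) ≤ v (Tuple.sort v k) + c := by
  by_contra! hlt
  have hsub : (Finset.Iic k).map (Tuple.sort v).toEmbedding ⊆
      (Finset.Iio k).map (Tuple.sort u).toEmbedding := by
    intro j hj
    obtain ⟨a, ha, rfl⟩ := Finset.mem_map.1 hj
    refine Finset.mem_map.2 ⟨(Tuple.sort u).symm (Tuple.sort v a), ?_, by simp⟩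
    rw [Finset.mem_Iio]
    by_contra! hk
    have h₁ := Tuple.monotone_sort u hk
    have h₂ := Tuple.monotone_sort v (Finset.mem_Iic.1 ha)
    simp only [Function.comp_apply, Equiv.apply_symm_apply] at h₁ h₂
    linarith [h (Tuple.sort v a)]
  simpa using Finset.card_le_card hsub

theorem lipschitzWith_orderStat {p : ℕ} :
    LipschitzWith 1 (orderStat : (Fin p → ℝ) → Fin p → ℝ) := by
  refine LipschitzWith.of_dist_le_mul fun u v => ?_
  rw [NNReal.coe_one, one_mul, dist_pi_le_iff dist_nonneg]
  intro i
  have hle : ∀ j, |u j - v j| ≤ dist u v := dist_le_pi_dist u v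
  rw [orderStat_eq_sort, orderStat_eq_sort, Real.dist_eq, abs_sub_le_iff]
  constructor
  · linarith [sort_le_sort_add (fun j => by linarith [(abs_le.1 (hle j)).2] :
      ∀ j, u j ≤ v j + dist u v) i.rev]
  · linarith [sort_le_sort_add (fun j => by linarith [(abs_le.1 (hle j)).1] :
      ∀ j, v j ≤ u j + dist u v) i.rev]

theorem LocallyLipschitz.pi {X ι : Type*} [PseudoEMetricSpace X] [Fintype ι] {Y : ι → Type*}
    [∀ j, PseudoEMetricSpace (Y j)] {f : ∀ j, X → Y j} (hf : ∀ j, LocallyLipschitz (f j)) :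
    LocallyLipschitz (fun x j => f j x) := by
  intro x
  choose K t ht hK using fun j => hf j x
  refine ⟨∑ j, K j, ⋂ j, t j, Filter.iInter_mem.2 ht, fun a ha b hb => edist_pi_le_iff.2 ?_⟩
  intro j
  refine (hK j (Set.mem_iInter.1 ha j) (Set.mem_iInter.1 hb j)).trans ?_
  gcongr
  exact Finset.single_le_sum (fun i _ => zero_le (a := K i)) (Finset.mem_univ j)

theorem LocallyLipschitz.contDiffAt_comp {X E F : Type*} [PseudoEMetricSpace X]
    [NormedAddCommGroup E] [NormedSpace ℝ E] [NormedAddCommGroup F] [NormedSpace ℝ F]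
    {G : E → F} {g : X → E} (hg : LocallyLipschitz g) (hG : ∀ x, ContDiffAt ℝ 1 G (g x)) :
    LocallyLipschitz (fun x => G (g x)) := by
  intro x
  obtain ⟨K, t, ht, hK⟩ := (hG x).exists_lipschitzOnWith
  obtain ⟨L, s, hs, hL⟩ := hg x
  refine ⟨K * L, s ∩ g ⁻¹' t, Filter.inter_mem hs (hg.continuous.continuousAt ht), ?_⟩
  exact hK.comp (hL.mono Set.inter_subset_left) fun y hy => hy.2

theorem contDiffAt_weighted_power_mean {ι : Type*} [Fintype ι] {w s : ι → ℝ} (lam : ℝ)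
    (hw : ∀ i, 0 ≤ w i) (hw1 : ∑ i, w i = 1) (hs : ∀ i, 0 < s i) :
    ContDiffAt ℝ 1 (fun s : ι → ℝ => (∑ i, w i * s i ^ lam) ^ (1 / lam)) s := by
  have hpos : 0 < ∑ i, w i * s i ^ lam := by
    obtain ⟨i, hi, hwi⟩ := Finset.exists_ne_zero_of_sum_ne_zero (hw1.trans_ne one_ne_zero)
    exact Finset.sum_pos' (fun j _ => mul_nonneg (hw j) (Real.rpow_nonneg (hs j).le _))
      ⟨i, hi, mul_pos ((hw i).lt_of_ne' hwi) (Real.rpow_pos_of_pos (hs i) _)⟩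
  refine ContDiffAt.rpow_const_of_ne (ContDiffAt.sum fun i _ => ?_) hpos.ne'
  exact contDiffAt_const.mul ((contDiffAt_apply ℝ ℝ i s).rpow_const_of_ne (hs i).ne')

/-- Theorem 3.2: local Lipschitz continuity of the GOWA robust objective `φ`
when the scenario objectives are locally Lipschitz and strictly positive. -/
theorem gowa_locallyLipschitz {n p : ℕ} (hp : 1 ≤ p)
    (f : Fin p → EuclideanSpace ℝ (Fin n) → ℝ)
    (hf : ∀ j, LocallyLipschitz (f j))
    (hf0 : ∀ j x, 0 < f j x)
    (lam : ℝ) (hlam : 0 < lam)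
    (w : Fin p → ℝ) (hw : ∀ i, 0 ≤ w i) (hw1 : ∑ i, w i = 1) :
    LocallyLipschitz (fun x => gowa w lam (fun j => f j x)) := by
  exact (lipschitzWith_orderStat.locallyLipschitz.comp (LocallyLipschitz.pi hf)).contDiffAt_comp
    fun x => contDiffAt_weighted_power_mean lam hw hw1 fun i => by
      simpa [orderStat_eq_sort] using hf0 _ x
end

section
/- (Coerciveness of the GOWA robust objective, Theorem 3.3.) Suppose each of the functions f_1, …, f_p : ℝ^n → ℝ is coercive and nonnegative, i.e., f_j(x) ≥ 0 for all x and all j. Then for every λ > 0 and every choice of weights w_1, …, w_p ≥ 0 with ∑_{i=1}^p w_i = 1, the GOWA robust objective function φ is coercive on ℝ^n; that is, φ(x) → +∞ as ‖x‖ → +∞. -/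
theorem orderStat_mem_range {p : ℕ} (v : Fin p → ℝ) (i : Fin p) :
    orderStat v i ∈ Set.range v := by
  classical
  have hi := i.isLt
  have hlt : Multiset.card (Finset.univ.val.map v) - 1 - i.val <
      ((Finset.univ.val.map v).sort (· ≤ ·)).length := by
    simp only [Multiset.length_sort, Multiset.card_map, Finset.card_val, Finset.card_univ,
      Fintype.card_fin]
    omega
  have hmem : orderStat v i ∈ Finset.univ.val.map v := by
    rw [orderStat, orderStatM, List.getD_eq_getElem _ _ hlt, ← Multiset.mem_sort (· ≤ ·)]
    exact List.getElem_mem hlt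
  simpa using hmem

theorem le_gowa {p : ℕ} {w : Fin p → ℝ} (hw : ∀ i, 0 ≤ w i) (hw1 : ∑ i, w i = 1)
    {lam : ℝ} (hlam : 0 < lam) {v : Fin p → ℝ} {c : ℝ} (hc : 0 ≤ c) (hv : ∀ j, c ≤ v j) :
    c ≤ gowa w lam v := by
  have hs : ∀ i, c ≤ orderStat v i := fun i => by
    obtain ⟨j, hj⟩ := orderStat_mem_range v i
    exact hj ▸ hv j
  calc c = (∑ i, w i * c ^ lam) ^ (1 / lam) := by
        rw [← Finset.sum_mul, hw1, one_mul, one_div, Real.rpow_rpow_inv hc hlam.ne']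
    _ ≤ gowa w lam v := by
        refine Real.rpow_le_rpow ?_ ?_ (by positivity)
        · exact Finset.sum_nonneg fun i _ => mul_nonneg (hw i) (Real.rpow_nonneg hc _)
        · exact Finset.sum_le_sum fun i _ => mul_le_mul_of_nonneg_left
            (Real.rpow_le_rpow hc (hs i) hlam.le) (hw i)

/-- Theorem 3.3: coerciveness of the GOWA robust objective `φ` when the scenario
objectives are coercive and nonnegative. -/
theorem gowa_coercive {n p : ℕ} (hp : 1 ≤ p)
    (f : Fin p → EuclideanSpace ℝ (Fin n) → ℝ)
    (hf : ∀ j, Filter.Tendsto (f j)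
      (Filter.comap (fun x : EuclideanSpace ℝ (Fin n) => ‖x‖) Filter.atTop) Filter.atTop)
    (hf0 : ∀ j x, 0 ≤ f j x)
    (lam : ℝ) (hlam : 0 < lam)
    (w : Fin p → ℝ) (hw : ∀ i, 0 ≤ w i) (hw1 : ∑ i, w i = 1) :
    Filter.Tendsto (fun x => gowa w lam (fun j => f j x))
      (Filter.comap (fun x : EuclideanSpace ℝ (Fin n) => ‖x‖) Filter.atTop) Filter.atTop := by
  refine Filter.tendsto_atTop.2 fun b => ?_
  have h := Filter.eventually_all.2 fun j => (hf j).eventually_ge_atTop (max b 0)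
  filter_upwards [h] with x hx
  exact (le_max_left b 0).trans (le_gowa hw hw1 hlam (le_max_right b 0) hx)
end

section
/- (Corollary to Theorem 3.4: monotonicity along a ray.) Let x̄, d ∈ ℝ^n. Suppose f_j(x) ≥ 0 for all x ∈ ℝ^n and all j, and suppose that for each j ∈ {1, …, p} the function t ↦ f_j(x̄ + t·d) is monotone increasing on ℝ. Then for every λ > 0 and every choice of weights w_1, …, w_p ≥ 0 with ∑_{i=1}^p w_i = 1, the function t ↦ φ(x̄ + t·d) is monotone increasing on ℝ. -/
theorem orderStat_eq_sort_rev {p : ℕ} (v : Fin p → ℝ) (i : Fin p) :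
    orderStat v i = (v ∘ Tuple.sort v) i.rev := by
  classical
  have key (dec : DecidableRel fun a b : ℝ => a ≤ b) :
      (Finset.univ.val.map v).sort (· ≤ ·) = List.ofFn (v ∘ Tuple.sort v) := by
    refine List.Perm.eq_of_pairwise' (r := (· ≤ ·)) (Multiset.pairwise_sort _ _)
      (Tuple.monotone_sort v).sortedLE_ofFn.pairwise ?_
    refine List.Perm.trans ?_ ((Tuple.sort v).ofFn_comp_perm v).symm
    rw [← Multiset.coe_eq_coe, Multiset.sort_eq, Fin.univ_val_map]
  have hi : p - 1 - i.val < p := by omega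
  unfold orderStat orderStatM
  rw [key]
  simp only [Multiset.card_map, Finset.card_val, Finset.card_univ, Fintype.card_fin]
  rw [List.getD_eq_getElem _ _ (by simpa using hi), List.getElem_ofFn]
  congr 1
  ext
  simp only [Fin.val_rev]
  omega

theorem Tuple.comp_sort_mono {p : ℕ} {α : Type*} [LinearOrder α] {u v : Fin p → α}
    (h : u ≤ v) : u ∘ Tuple.sort u ≤ v ∘ Tuple.sort v := by
  intro k
  have card_comp (g : Fin p → α) (a : α) :
      Finset.card {i | (g ∘ Tuple.sort g) i ≤ a} = Finset.card {i | g i ≤ a} :=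
    Finset.card_equiv (Tuple.sort g) (by simp)
  rw [← Tuple.lt_card_le_iff_apply_le_of_monotone (Tuple.monotone_sort u), card_comp]
  refine lt_of_lt_of_le ((Tuple.lt_card_le_iff_apply_le_of_monotone
    (Tuple.monotone_sort v)).2 le_rfl) ?_
  rw [card_comp]
  exact Finset.card_le_card (Finset.monotone_filter_right _ fun i _ hi => (h i).trans hi)

theorem orderStat_mono {p : ℕ} {u v : Fin p → ℝ} (h : u ≤ v) (i : Fin p) :
    orderStat u i ≤ orderStat v i := by
  simpa only [orderStat_eq_sort_rev] using Tuple.comp_sort_mono h i.rev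

theorem orderStat_nonneg {p : ℕ} {v : Fin p → ℝ} (h : 0 ≤ v) (i : Fin p) :
    0 ≤ orderStat v i := by
  rw [orderStat_eq_sort_rev]
  exact h _

theorem gowa_mono {p : ℕ} {w : Fin p → ℝ} (hw : 0 ≤ w) {lam : ℝ} (hlam : 0 ≤ lam)
    {u v : Fin p → ℝ} (hu : 0 ≤ u) (h : u ≤ v) : gowa w lam u ≤ gowa w lam v := by
  refine Real.rpow_le_rpow
    (Finset.sum_nonneg fun i _ => mul_nonneg (hw i) (Real.rpow_nonneg (orderStat_nonneg hu i) _))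
    (Finset.sum_le_sum fun i _ => mul_le_mul_of_nonneg_left ?_ (hw i)) (by positivity)
  exact Real.rpow_le_rpow (orderStat_nonneg hu i) (orderStat_mono h i) hlam

/-- Corollary to Theorem 3.4 (monotonicity along a ray): if every scenario objective
is nonnegative and increasing along the ray `t ↦ x̄ + t • d`, then so is `φ`. -/
theorem gowa_monotone_along_ray {n p : ℕ} (hp : 1 ≤ p)
    (f : Fin p → EuclideanSpace ℝ (Fin n) → ℝ)
    (xbar d : EuclideanSpace ℝ (Fin n))
    (hf0 : ∀ j x, 0 ≤ f j x)
    (hmono : ∀ j, Monotone (fun t : ℝ => f j (xbar + t • d)))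
    (lam : ℝ) (hlam : 0 < lam)
    (w : Fin p → ℝ) (hw : ∀ i, 0 ≤ w i) (hw1 : ∑ i, w i = 1) :
    Monotone (fun t : ℝ => gowa w lam (fun j => f j (xbar + t • d))) := by
  exact fun s t hst => gowa_mono hw hlam.le (fun j => hf0 j _) fun j => hmono j hst
end

section
/- (Lemma 5.1: local representation of the ℓ-th order statistic near a point with ties.) Suppose each f_j : ℝ^n → ℝ is continuous. Fix x̄ ∈ ℝ^n, set c := s_ℓ(x̄) for some ℓ ∈ {1, …, p}, let K := { j ∈ {1, …, p} : f_j(x̄) = c }, and assume that ℓ is the least index with s_ℓ(x̄) = c, i.e., exactly ℓ − 1 of the values f_1(x̄), …, f_p(x̄) are strictly greater than c. Then there exists δ > 0 such that for every x ∈ ℝ^n with ‖x − x̄‖ < δ, one has s_ℓ(x) = max_{j ∈ K} f_j(x). -/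
/-- A value `m` such that at most `i` elements exceed `m` while more than `i` elements are at
least `m` is the `i`-th largest element. -/
theorem orderStatM_eq_of_countP {s : Multiset ℝ} {i : ℕ} {m : ℝ}
    (hgt : s.countP (m < ·) ≤ i) (hge : i < s.countP (m ≤ ·)) : orderStatM s i = m := by
  classical
  have hi : i < Multiset.card s := hge.trans_le (Multiset.countP_le_card _ _)
  unfold orderStatM
  set L := s.sort (· ≤ ·) with hL
  have hs : s = (L : Multiset ℝ) := (Multiset.sort_eq s _).symm
  have hlen : L.length = Multiset.card s := Multiset.length_sort _
  have hsorted : L.SortedLE := (Multiset.pairwise_sort s (· ≤ ·)).sortedLE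
  rw [hs, Multiset.coe_countP] at hgt hge
  rw [← hlen] at hi ⊢
  have hk : L.length - 1 - i < L.length := by omega
  rw [List.getD_eq_getElem _ _ hk]
  set k := L.length - 1 - i with hkdef
  refine le_antisymm (not_lt.1 fun hlt => ?_) (not_lt.1 fun hlt => ?_)
  · have hdrop : (L.drop k).countP (m < ·) = (L.drop k).length := by
      rw [List.countP_eq_length]
      intro a ha
      obtain ⟨j, hj, rfl⟩ := List.getElem_of_mem ha
      rw [List.getElem_drop]
      exact decide_eq_true (hlt.trans_le (hsorted.getElem_le_getElem_of_le (by omega)))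
    have := (List.drop_sublist k L).countP_le (p := (m < ·))
    rw [hdrop, List.length_drop] at this
    omega
  · have htake : (L.take (k + 1)).countP (m ≤ ·) = 0 := by
      rw [List.countP_eq_zero]
      intro a ha
      obtain ⟨j, hj, rfl⟩ := List.getElem_of_mem ha
      rw [List.length_take] at hj
      rw [List.getElem_take]
      simpa using (hsorted.getElem_le_getElem_of_le (by omega)).trans_lt hlt
    have hsplit := congrArg (List.countP (m ≤ ·)) (List.take_append_drop (k + 1) L)
    rw [List.countP_append, htake] at hsplit
    have := List.countP_le_length (p := (m ≤ ·)) (l := L.drop (k + 1))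
    rw [List.length_drop] at this
    omega

/-- `orderStatM_eq_of_countP` for finite families. -/
theorem orderStat_eq_of_card {p : ℕ} {v : Fin p → ℝ} {i : Fin p} {m : ℝ}
    (hgt : (Finset.univ.filter (fun j => m < v j)).card ≤ i.val)
    (hge : i.val < (Finset.univ.filter (fun j => m ≤ v j)).card) : orderStat v i = m := by
  apply orderStatM_eq_of_countP
  · rwa [Multiset.countP_map]
  · rwa [Multiset.countP_map]

/-- If the values off `K` are separated from the maximum over `K` by `P` (above) and `¬ P`
(below), then the order statistic of index `#{j | P j}` is that maximum. -/
theorem orderStat_eq_sup' {p : ℕ} {v : Fin p → ℝ} {i : Fin p} {P : Fin p → Prop}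
    [DecidablePred P] {K : Finset (Fin p)} (hK : K.Nonempty)
    (hcard : (Finset.univ.filter P).card = i.val) (hKP : ∀ j ∈ K, ¬ P j)
    (habove : ∀ j, P j → K.sup' hK v < v j)
    (hbelow : ∀ j, ¬ P j → v j ≤ K.sup' hK v) : orderStat v i = K.sup' hK v := by
  apply orderStat_eq_of_card
  · rw [← hcard]
    refine Finset.card_le_card fun j hj => ?_
    simp only [Finset.mem_filter, Finset.mem_univ, true_and] at hj ⊢
    exact not_not.1 fun h => (hbelow j h).not_gt hj
  · rw [← hcard]
    obtain ⟨k, hk, hkv⟩ := K.exists_mem_eq_sup' hK v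
    refine Finset.card_lt_card (Finset.ssubset_iff_of_subset (fun j hj => ?_) |>.2 ⟨k, ?_, ?_⟩)
    · simp only [Finset.mem_filter, Finset.mem_univ, true_and] at hj ⊢
      exact (habove j hj).le
    · simp [hkv]
    · simpa using hKP k hk

/-- Lemma 5.1: local representation of the `ℓ`-th order statistic near a point with
ties. Here `ℓ : Fin p` is 0-indexed, so "exactly `ℓ − 1` values strictly greater
than `c`" of the paper becomes `card = ℓ.val`, and `s_ℓ = orderStat · ℓ`. -/
theorem order_statistic_local_max_representation {n p : ℕ}
    (f : Fin p → EuclideanSpace ℝ (Fin n) → ℝ)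
    (hf : ∀ j, Continuous (f j))
    (xbar : EuclideanSpace ℝ (Fin n)) (ℓ : Fin p) (c : ℝ)
    (hc : c = orderStat (fun j => f j xbar) ℓ)
    (K : Finset (Fin p)) (hK : K = Finset.univ.filter (fun j => f j xbar = c))
    (hKne : K.Nonempty)
    (hleast : (Finset.univ.filter (fun j => c < f j xbar)).card = ℓ.val) :
    ∃ δ > (0 : ℝ), ∀ x : EuclideanSpace ℝ (Fin n), ‖x - xbar‖ < δ →
      orderStat (fun j => f j x) ℓ = K.sup' hKne (fun j => f j x) := by
  subst hK
  have hev : ∀ᶠ x in nhds xbar, ∀ j k, f j xbar < f k xbar → f j x < f k x := by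
    simp only [Filter.eventually_all]
    exact fun j k h => (hf j).continuousAt.eventually_lt (hf k).continuousAt h
  obtain ⟨δ, hδ, hball⟩ := Metric.eventually_nhds_iff.1 hev
  refine ⟨δ, hδ, fun x hx => ?_⟩
  replace hball := hball (dist_eq_norm x xbar ▸ hx)
  refine orderStat_eq_sup' hKne hleast (fun j hj => ?_) (fun j hj => ?_) fun j hj => ?_
  · exact (Finset.mem_filter.1 hj).2.not_gt
  · rw [Finset.sup'_lt_iff]
    exact fun k hk => hball k j ((Finset.mem_filter.1 hk).2.trans_lt hj)
  · rcases (not_lt.1 hj).lt_or_eq with h | h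
    · obtain ⟨k, hk⟩ := id hKne
      exact (hball j k (h.trans_eq (Finset.mem_filter.1 hk).2.symm)).le.trans
        (Finset.le_sup' (fun j => f j x) hk)
    · exact Finset.le_sup' (fun j => f j x) (Finset.mem_filter.2 ⟨Finset.mem_univ j, h⟩)
end
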